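/- Let M be a countably infinite set and G ≤ Sym(M) a primitive, oligomorphic permutation group with no algebraicity. Let Ω = [0,1]^M carry the product σ-algebra and the shift action (g·ω)(a) = ω(g⁻¹·a). Then every G-invariant, ergodic Borel probability measure on Ω is of the form λ^{⊗M} for some Borel probability measure λ on [0,1], i.e., the coordinates are independent and identically distributed. -/

import Mathlib

open MeasureTheory ProbabilityTheory

/-- The shift action of a permutation `g` of `M` on configurations `ω : M → [0,1]`:
`(g · ω)(a) = ω (g⁻¹ a)`. -/
def shiftAct {M : Type*} (g : Equiv.Perm M) (ω : M → unitInterval) : M → unitInterval :=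
  fun a => ω (g⁻¹ a)

/-- A permutation group `G ≤ Sym(M)` is oligomorphic if the diagonal action of `G` on `Mⁿ`
has finitely many orbits for every `n`. -/
def Oligomorphic {M : Type*} (G : Subgroup (Equiv.Perm M)) : Prop :=
  ∀ n : ℕ, Finite (Quotient (MulAction.orbitRel G (Fin n → M)))

/-- A conditional expectation of a `T`-invariant function with respect to a `T`-invariant
σ-algebra is almost everywhere `T`-invariant. -/
theorem condExp_comp_ae_eq_of_comp_eq {Ω : Type*} {m m₀ : MeasurableSpace Ω} (hm : m ≤ m₀)
    {μ : Measure Ω} [IsFiniteMeasure μ] {T T' : Ω → Ω} (hT : MeasurePreserving T μ μ)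
    (hTm : Measurable[m, m] T) (hTm' : Measurable[m, m] T') (hTT' : T' ∘ T = id)
    {f : Ω → ℝ} (hf : Integrable f μ) (hfT : f ∘ T = f) :
    μ[f | m] ∘ T =ᵐ[μ] μ[f | m] := by
  refine ae_eq_condExp_of_forall_setIntegral_eq hm hf
    (fun s _ _ => (hT.integrable_comp_of_integrable integrable_condExp).integrableOn) ?_
    (stronglyMeasurable_condExp.comp_measurable hTm).aestronglyMeasurable
  intro s hs _
  have hs' : MeasurableSet[m] (T' ⁻¹' s) := hTm' hs
  have hpre : T ⁻¹' (T' ⁻¹' s) = s := by rw [← Set.preimage_comp, hTT', Set.preimage_id]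
  have key : ∀ u : Ω → ℝ, Integrable u μ → ∫ x in s, u (T x) ∂μ = ∫ x in T' ⁻¹' s, u x ∂μ := by
    intro u hu
    have := setIntegral_map (μ := μ) (g := T) (f := u) (hm _ hs')
      (by rw [hT.map_eq]; exact hu.aestronglyMeasurable) hT.aemeasurable
    rw [hT.map_eq, hpre] at this
    exact this.symm
  calc ∫ x in s, (μ[f | m] ∘ T) x ∂μ = ∫ x in T' ⁻¹' s, (μ[f | m]) x ∂μ :=
        key _ integrable_condExp
    _ = ∫ x in T' ⁻¹' s, f x ∂μ := setIntegral_condExp hm hf hs'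
    _ = ∫ x in s, (f ∘ T) x ∂μ := (key f hf).symm
    _ = ∫ x in s, f x ∂μ := by rw [hfT]

section Shift

variable {M : Type*}

theorem shiftAct_comp (g h : Equiv.Perm M) : shiftAct g ∘ shiftAct h = shiftAct (g * h) := by
  funext ω a
  simp [shiftAct]

theorem shiftAct_one : shiftAct (1 : Equiv.Perm M) = id := rfl

theorem measurable_shiftAct (g : Equiv.Perm M) : Measurable (shiftAct g) :=
  measurable_pi_lambda _ fun a => measurable_pi_apply (g⁻¹ a)

/-- The σ-algebra on `[0,1]^M` generated by the coordinates in `A`. -/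
@[reducible]
def coordSigma (A : Set M) : MeasurableSpace (M → unitInterval) :=
  ⨆ a ∈ A, MeasurableSpace.comap (fun ω => ω a) inferInstance

theorem coordSigma_le (A : Set M) : coordSigma A ≤ MeasurableSpace.pi :=
  iSup₂_le fun a _ => (measurable_pi_apply a).comap_le

theorem measurable_coord {A : Set M} {a : M} (ha : a ∈ A) :
    Measurable[coordSigma A] fun ω : M → unitInterval => ω a :=
  measurable_iff_comap_le.2
    (le_iSup₂ (f := fun a (_ : a ∈ A) =>
      MeasurableSpace.comap (fun ω : M → unitInterval => ω a) inferInstance) a ha)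

theorem coordSigma_mono : Monotone (coordSigma (M := M)) :=
  fun _ _ h => iSup₂_le fun _ ha => (measurable_coord (h ha)).comap_le

theorem measurable_shiftAct_coordSigma {A : Set M} {g : Equiv.Perm M}
    (hg : ∀ a ∈ A, g⁻¹ a ∈ A) : Measurable[coordSigma A, coordSigma A] (shiftAct g) := by
  rw [measurable_iff_comap_le]
  simp only [MeasurableSpace.comap_iSup, MeasurableSpace.comap_comp]
  exact iSup₂_le fun a ha => (measurable_coord (hg a ha)).comap_le

theorem coordSigma_le_invariants {A : Set M} {g : Equiv.Perm M} (hg : ∀ a ∈ A, g a = a) :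
    coordSigma A ≤ MeasurableSpace.invariants (shiftAct g) := by
  refine iSup₂_le fun a ha => ?_
  rintro _ ⟨s, hs, rfl⟩
  refine ⟨measurable_pi_apply a hs, ?_⟩
  ext ω
  simp [shiftAct, Equiv.Perm.inv_eq_iff_eq.2 (hg a ha).symm]

/-- The increasing sequence of σ-algebras generated by finitely many coordinates in `A`. -/
def coordFiltration [Encodable M] (A : Set M) :
    Filtration ℕ (MeasurableSpace.pi : MeasurableSpace (M → unitInterval)) where
  seq n := coordSigma {a | a ∈ A ∧ Encodable.encode a < n}
  mono' _ _ h := coordSigma_mono fun _ ha => ⟨ha.1, ha.2.trans_le h⟩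
  le' _ := coordSigma_le _

theorem iSup_coordFiltration [Encodable M] (A : Set M) :
    ⨆ n, coordFiltration A n = coordSigma A := by
  refine le_antisymm (iSup_le fun n => coordSigma_mono fun _ ha => ha.1)
    (iSup₂_le fun a ha => ?_)
  exact (measurable_coord (A := {b | b ∈ A ∧ Encodable.encode b < Encodable.encode a + 1})
    ⟨ha, Nat.lt_succ_self _⟩).comap_le.trans (le_iSup (coordFiltration A) (Encodable.encode a + 1))

variable {G : Subgroup (Equiv.Perm M)} {μ : Measure (M → unitInterval)}

theorem measurePreserving_shiftAct (hinv : ∀ g ∈ G, μ.map (shiftAct g) = μ) (g : G) :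
    MeasurePreserving (shiftAct (g : Equiv.Perm M)) μ μ :=
  ⟨measurable_shiftAct _, hinv _ g.2⟩

/-- The subgroup of `G` fixing the function `e` almost everywhere. -/
def aeStabilizer (hinv : ∀ g ∈ G, μ.map (shiftAct g) = μ) (e : (M → unitInterval) → ℝ) :
    Subgroup G where
  carrier := {g | e ∘ shiftAct (g : Equiv.Perm M) =ᵐ[μ] e}
  one_mem' := by
    change e ∘ shiftAct 1 =ᵐ[μ] e
    rw [shiftAct_one]; rfl
  mul_mem' {g h} hg hh := by
    have := (measurePreserving_shiftAct hinv h).quasiMeasurePreserving.ae_eq_comp hg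
    rw [Function.comp_assoc, shiftAct_comp] at this
    exact this.trans hh
  inv_mem' {g} hg := by
    have := (measurePreserving_shiftAct hinv g⁻¹).quasiMeasurePreserving.ae_eq_comp hg
    rw [Function.comp_assoc, shiftAct_comp, ← Subgroup.coe_mul, mul_inv_cancel,
      Subgroup.coe_one, shiftAct_one] at this
    exact this.symm

theorem mem_aeStabilizer (hinv : ∀ g ∈ G, μ.map (shiftAct g) = μ) {e : (M → unitInterval) → ℝ}
    {g : G} : g ∈ aeStabilizer hinv e ↔ e ∘ shiftAct (g : Equiv.Perm M) =ᵐ[μ] e :=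
  Iff.rfl

/-- A measurable function fixed by an ergodic group is almost everywhere constant. -/
theorem ae_eq_const_of_aeStabilizer_eq_top
    (hinv : ∀ g ∈ G, μ.map (shiftAct g) = μ) [IsProbabilityMeasure μ]
    (herg : ∀ E : Set (M → unitInterval), MeasurableSet E →
      (∀ g ∈ G, μ (symmDiff (shiftAct g ⁻¹' E) E) = 0) → μ E = 0 ∨ μ E = 1)
    {e : (M → unitInterval) → ℝ} (he : Measurable e) (htop : aeStabilizer hinv e = ⊤) :
    ∃ c : ℝ, e =ᵐ[μ] fun _ => c := by
  refine Filter.exists_eventuallyEq_const_of_forall_separating MeasurableSet fun U hU => ?_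
  have h01 := herg (e ⁻¹' U) (he hU) fun g hg => by
    have hge : (⟨g, hg⟩ : G) ∈ aeStabilizer hinv e := htop ▸ Subgroup.mem_top _
    rw [measure_symmDiff_eq_zero_iff]
    exact Filter.EventuallyEq.preimage ((mem_aeStabilizer hinv).1 hge) U
  rcases h01 with h | h
  · right
    exact measure_eq_zero_iff_ae_notMem.1 h
  · left
    exact (prob_compl_eq_zero_iff (he hU)).2 h

/-- If `G` has finitely many orbits on pairs and `e` is fixed by the stabilizer of `b`, then the
translates of `e` are uniformly separated from `e`. -/
theorem exists_pos_forall_eLpNorm_lt (holig : Oligomorphic G)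
    (hinv : ∀ g ∈ G, μ.map (shiftAct g) = μ) {e : (M → unitInterval) → ℝ} (he : Measurable e)
    {b : M} (hb : MulAction.stabilizer G b ≤ aeStabilizer hinv e) :
    ∃ δ : ENNReal, 0 < δ ∧ ∀ g : G,
      eLpNorm (e ∘ shiftAct (g : Equiv.Perm M) - e) 1 μ < δ → g ∈ aeStabilizer hinv e := by
  have := holig 2
  let D : G → ENNReal := fun g => eLpNorm (e ∘ shiftAct (g : Equiv.Perm M) - e) 1 μ
  let q : G → Quotient (MulAction.orbitRel G (Fin 2 → M)) :=
    fun g => Quotient.mk _ ![b, g • b]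
  have hDq : ∀ g g', q g = q g' → D g = D g' := by
    intro g g' hq
    obtain ⟨h, hh⟩ := Quotient.exact hq
    have h0 : h • b = b := by simpa using congrFun hh 0
    have h1 : h • g' • b = g • b := by simpa using congrFun hh 1
    have hk : g'⁻¹ * h⁻¹ * g ∈ MulAction.stabilizer G b := by
      rw [MulAction.mem_stabilizer_iff, mul_smul, mul_smul, ← h1, inv_smul_smul, inv_smul_smul]
    set k := g'⁻¹ * h⁻¹ * g with hkdef
    have hg : g = h * g' * k := by rw [hkdef]; group
    have hhe : e ∘ shiftAct (h : Equiv.Perm M) =ᵐ[μ] e := hb h0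
    have hke : e ∘ shiftAct (k : Equiv.Perm M) =ᵐ[μ] e := hb hk
    have hleft : e ∘ shiftAct (g : Equiv.Perm M) =ᵐ[μ]
        e ∘ shiftAct ((g' * k : G) : Equiv.Perm M) := by
      have := (measurePreserving_shiftAct hinv (g' * k)).quasiMeasurePreserving.ae_eq_comp hhe
      rwa [Function.comp_assoc, shiftAct_comp, ← Subgroup.coe_mul, ← mul_assoc, ← hg] at this
    have hdiff : e ∘ shiftAct (g : Equiv.Perm M) - e =ᵐ[μ]
        (e ∘ shiftAct (g' : Equiv.Perm M) - e) ∘ shiftAct (k : Equiv.Perm M) := by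
      refine (hleft.sub hke.symm).trans (Filter.EventuallyEq.of_eq ?_)
      rw [Subgroup.coe_mul, ← shiftAct_comp]
      rfl
    change eLpNorm _ 1 μ = eLpNorm _ 1 μ
    rw [eLpNorm_congr_ae hdiff]
    exact eLpNorm_comp_measurePreserving
      ((he.comp (measurable_shiftAct _)).sub he).aestronglyMeasurable
      (measurePreserving_shiftAct hinv k)
  have hfin : (Set.range D).Finite := by
    have hqfin : (Set.range q).Finite := Set.toFinite _
    choose! s hs using fun x (hx : x ∈ Set.range q) => hx
    refine (hqfin.image (D ∘ s)).subset ?_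
    rintro _ ⟨g, rfl⟩
    exact ⟨q g, ⟨g, rfl⟩, hDq _ _ (hs _ ⟨g, rfl⟩)⟩
  have hfin' : (Set.range D \ {0}).Finite := hfin.subset Set.sdiff_subset
  have hopen : (Set.range D \ {0})ᶜ ∈ nhds (0 : ENNReal) :=
    hfin'.isClosed.isOpen_compl.mem_nhds (by simp)
  obtain ⟨δ, hδ, hsub⟩ := ENNReal.nhds_zero_basis.mem_iff.1 hopen
  refine ⟨δ, hδ, fun g hg => ?_⟩
  have h0 : D g = 0 := by
    by_contra h
    exact hsub hg ⟨⟨g, rfl⟩, h⟩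
  have := (eLpNorm_eq_zero_iff
    ((he.comp (measurable_shiftAct (g : Equiv.Perm M))).sub he).aestronglyMeasurable
    one_ne_zero).1 h0
  exact Filter.eventuallyEq_iff_sub.2 this

/-- The conditional expectation of a function of the coordinate `b` given all other coordinates
is constant. -/
theorem condExp_coord_ae_eq_const [Countable M]
    (hprim : ∀ a : M, IsCoatom (MulAction.stabilizer G a))
    (holig : Oligomorphic G)
    (hnoalg : ∀ A : Set M, A.Finite → ∀ b ∉ A,
      {c : M | ∃ g ∈ G, (∀ a ∈ A, g a = a) ∧ g b = c}.Infinite)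
    [IsProbabilityMeasure μ]
    (hinv : ∀ g ∈ G, μ.map (shiftAct g) = μ)
    (herg : ∀ E : Set (M → unitInterval), MeasurableSet E →
      (∀ g ∈ G, μ (symmDiff (shiftAct g ⁻¹' E) E) = 0) → μ E = 0 ∨ μ E = 1)
    (b : M) {X : (M → unitInterval) → ℝ} (hX : Integrable X μ)
    (hXb : ∀ g : Equiv.Perm M, g b = b → X ∘ shiftAct g = X) :
    ∃ c : ℝ, μ[X | coordSigma {a | a ≠ b}] =ᵐ[μ] fun _ => c := by
  have := Encodable.ofCountable M
  set e := μ[X | coordSigma {a | a ≠ b}] with hedef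
  have he : Measurable e :=
    (stronglyMeasurable_condExp.mono (coordSigma_le {a | a ≠ b})).measurable
  have hb : MulAction.stabilizer G b ≤ aeStabilizer hinv e := by
    intro g hg
    have hgb : (g : Equiv.Perm M) b = b := hg
    refine condExp_comp_ae_eq_of_comp_eq (T' := shiftAct (g : Equiv.Perm M)⁻¹)
      (coordSigma_le _) (measurePreserving_shiftAct hinv g) ?_ ?_ ?_ hX (hXb _ hgb)
    · refine measurable_shiftAct_coordSigma fun a ha h => ha ?_
      rw [Equiv.Perm.inv_eq_iff_eq.1 h, hgb]
    · refine measurable_shiftAct_coordSigma fun a ha h => ha ?_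
      rw [inv_inv, ← hgb] at h
      exact (g : Equiv.Perm M).injective h
    · rw [shiftAct_comp, inv_mul_cancel, shiftAct_one]
  obtain ⟨δ, hδ, hsep⟩ := exists_pos_forall_eLpNorm_lt holig hinv he hb
  have hlim := tendsto_eLpNorm_condExp (μ := μ) (ℱ := coordFiltration {a | a ≠ b}) X
  rw [iSup_coordFiltration, ← hedef] at hlim
  obtain ⟨n, hn⟩ := (hlim.eventually (gt_mem_nhds (ENNReal.half_pos hδ.ne'))).exists
  set A : Set M := {a | a ≠ b ∧ Encodable.encode a < n} with hA
  set h := μ[X | coordFiltration {a | a ≠ b} n] with hhdef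
  have hAm : Measurable[coordSigma A] h := stronglyMeasurable_condExp.measurable
  have hm : Measurable h := hAm.mono (coordSigma_le A) le_rfl
  have hAfin : A.Finite :=
    ((Set.finite_Iio n).preimage Encodable.encode_injective.injOn).subset fun _ ha => ha.2
  have hfix : ∀ g : G, (∀ a ∈ A, (g : Equiv.Perm M) a = a) → g ∈ aeStabilizer hinv e := by
    intro g hg
    apply hsep
    have hhg : h ∘ shiftAct (g : Equiv.Perm M) = h :=
      MeasurableSpace.comp_eq_of_measurable_invariants
        (hAm.mono (coordSigma_le_invariants hg) le_rfl)
    have hsplit : e ∘ shiftAct (g : Equiv.Perm M) - e =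
        (h - e) - (h - e) ∘ shiftAct (g : Equiv.Perm M) := by
      funext ω
      have := congrFun hhg ω
      simp only [Function.comp_apply, Pi.sub_apply] at this ⊢
      rw [this]; ring
    have hsm : AEStronglyMeasurable (h - e) μ := (hm.sub he).aestronglyMeasurable
    have hmp := measurePreserving_shiftAct hinv g
    calc eLpNorm (e ∘ shiftAct (g : Equiv.Perm M) - e) 1 μ
        ≤ eLpNorm (h - e) 1 μ + eLpNorm ((h - e) ∘ shiftAct (g : Equiv.Perm M)) 1 μ := by
          rw [hsplit]
          exact eLpNorm_sub_le hsm (hsm.comp_measurePreserving hmp) le_rfl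
      _ = eLpNorm (h - e) 1 μ + eLpNorm (h - e) 1 μ := by
          rw [eLpNorm_comp_measurePreserving hsm hmp]
      _ < δ / 2 + δ / 2 := ENNReal.add_lt_add hn hn
      _ = δ := ENNReal.add_halves δ
  obtain ⟨c, ⟨g, hgG, hgA, hgc⟩, hcb⟩ := (hnoalg A hAfin b fun hb => hb.1 rfl).exists_notMem_finite
    (Set.finite_singleton b)
  refine ae_eq_const_of_aeStabilizer_eq_top hinv herg he ((hprim b).2 _ (lt_of_le_of_ne hb ?_))
  intro heq
  have hmem : (⟨g, hgG⟩ : G) ∈ MulAction.stabilizer G b := heq ▸ hfix ⟨g, hgG⟩ hgA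
  exact hcb (hgc.symm.trans hmem)

end Shift

/-- de Finetti's theorem for primitive oligomorphic permutation groups with
no algebraicity: every invariant ergodic probability measure on `[0,1]^M` is an i.i.d.
product measure `λ^{⊗M}`. -/
theorem ergodic_invariant_measure_iid_of_primitive_oligomorphic
    {M : Type*} [Countable M] [Infinite M] (G : Subgroup (Equiv.Perm M))
    (htrans : MulAction.IsPretransitive G M)
    (hprim : ∀ a : M, IsCoatom (MulAction.stabilizer G a))
    (holig : Oligomorphic G)
    (hnoalg : ∀ A : Set M, A.Finite → ∀ b ∉ A,
      {c : M | ∃ g ∈ G, (∀ a ∈ A, g a = a) ∧ g b = c}.Infinite)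
    (μ : Measure (M → unitInterval)) [IsProbabilityMeasure μ]
    (hinv : ∀ g ∈ G, μ.map (shiftAct g) = μ)
    (herg : ∀ E : Set (M → unitInterval), MeasurableSet E →
      (∀ g ∈ G, μ (symmDiff (shiftAct g ⁻¹' E) E) = 0) → μ E = 0 ∨ μ E = 1) :
    ∃ lam : Measure unitInterval, IsProbabilityMeasure lam ∧
      ∀ (S : Finset M) (s : M → Set unitInterval), (∀ a ∈ S, MeasurableSet (s a)) →
        μ {ω : M → unitInterval | ∀ a ∈ S, ω a ∈ s a} = ∏ a ∈ S, lam (s a) := by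
  obtain ⟨a₀⟩ : Nonempty M := inferInstance
  have heval : ∀ b : M, μ.map (fun ω => ω b) = μ.map (fun ω => ω a₀) := by
    intro b
    obtain ⟨g, hg⟩ := htrans.exists_smul_eq b a₀
    have hgb : (g : Equiv.Perm M)⁻¹ a₀ = b := Equiv.Perm.inv_eq_iff_eq.2 hg.symm
    conv_rhs => rw [← hinv g g.2, Measure.map_map (measurable_pi_apply a₀) (measurable_shiftAct _)]
    congr 1
    funext ω
    simp [shiftAct, hgb]
  have hindep : ∀ (b : M) (s : Set unitInterval), MeasurableSet s →
      ∀ E, MeasurableSet[coordSigma {a | a ≠ b}] E →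
        μ ((fun ω => ω b) ⁻¹' s ∩ E) = μ ((fun ω => ω b) ⁻¹' s) * μ E := by
    intro b s hs E hE
    have hB : MeasurableSet ((fun ω : M → unitInterval => ω b) ⁻¹' s) := measurable_pi_apply b hs
    set B := (fun ω : M → unitInterval => ω b) ⁻¹' s with hBdef
    have hX : Integrable (B.indicator (1 : (M → unitInterval) → ℝ)) μ :=
      (integrable_const 1).indicator hB
    obtain ⟨c, hc⟩ := condExp_coord_ae_eq_const hprim holig hnoalg hinv herg b hX (by
      intro g hg
      have hg' : g⁻¹ b = b := Equiv.Perm.inv_eq_iff_eq.2 hg.symm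
      funext ω
      have hmem : shiftAct g ω ∈ B ↔ ω ∈ B := by simp [hBdef, shiftAct, hg']
      by_cases h : ω ∈ B <;> simp [h, hmem])
    have hint : ∀ F, MeasurableSet[coordSigma {a | a ≠ b}] F → μ.real (B ∩ F) = c * μ.real F := by
      intro F hF
      have h1 := setIntegral_condExp (coordSigma_le {a | a ≠ b}) hX hF
      rw [setIntegral_congr_ae (g := fun _ => c) (coordSigma_le _ _ hF)
        (hc.mono fun _ h _ => h), integral_indicator_one hB,
        setIntegral_const, measureReal_restrict_apply hB] at h1
      rw [← h1, smul_eq_mul, mul_comm]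
    have hcB : μ.real B = c := by simpa using hint Set.univ MeasurableSet.univ
    have hfinal := hint E hE
    rw [← hcB, measureReal_def, measureReal_def, measureReal_def, ← ENNReal.toReal_mul] at hfinal
    exact (ENNReal.toReal_eq_toReal_iff' (measure_ne_top _ _)
      (ENNReal.mul_ne_top (measure_ne_top _ _) (measure_ne_top _ _))).1 hfinal
  refine ⟨μ.map (fun ω => ω a₀),
    Measure.isProbabilityMeasure_map (measurable_pi_apply a₀).aemeasurable, fun S s => ?_⟩
  classical
  induction S using Finset.induction_on with
  | empty => simp
  | insert b S hbS ih =>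
    intro hs
    have hE : MeasurableSet[coordSigma {a | a ≠ b}]
        {ω : M → unitInterval | ∀ a ∈ S, ω a ∈ s a} := by
      have : {ω : M → unitInterval | ∀ a ∈ S, ω a ∈ s a} =
          ⋂ a ∈ S, (fun ω : M → unitInterval => ω a) ⁻¹' s a := by
        ext; simp
      rw [this]
      refine Finset.measurableSet_biInter S fun a ha => ?_
      exact measurable_coord (A := {a | a ≠ b}) (ne_of_mem_of_not_mem ha hbS)
        (hs a (Finset.mem_insert_of_mem ha))
    have hsplit : {ω : M → unitInterval | ∀ a ∈ insert b S, ω a ∈ s a} =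
        (fun ω => ω b) ⁻¹' s b ∩ {ω | ∀ a ∈ S, ω a ∈ s a} := by
      ext; simp
    have hsb : MeasurableSet (s b) := hs b (Finset.mem_insert_self b S)
    rw [hsplit, hindep b (s b) hsb _ hE, Finset.prod_insert hbS,
      ih fun a ha => hs a (Finset.mem_insert_of_mem ha), ← heval b,
      Measure.map_apply (measurable_pi_apply b) hsb]
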